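/- Let E be a finite-dimensional real normed vector space, let F be a Minkowski gauge on E, and let v ∈ E satisfy F(-v) < 1. Then there exists a unique function F̃ : E → ℝ satisfying the navigation identity F̃(y + F(y)•v) = F(y) for all y ∈ E; moreover this F̃ is positively homogeneous (F̃(λ•w) = λ·F̃(w) for all λ ≥ 0) and satisfies F̃(w) > 0 for every w ≠ 0. -/

import Mathlib

/-- A convex, positively homogeneous function is subadditive. -/
theorem ConvexOn.map_add_le_of_posHomogeneous {E : Type*} [AddCommGroup E] [Module ℝ E]
    {F : E → ℝ} (hconv : ConvexOn ℝ Set.univ F)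
    (hhom : ∀ c : ℝ, 0 ≤ c → ∀ y : E, F (c • y) = c * F y) (x y : E) :
    F (x + y) ≤ F x + F y := by
  have h := hconv.2 (Set.mem_univ x) (Set.mem_univ y) (show (0 : ℝ) ≤ 1 / 2 by norm_num)
    (show (0 : ℝ) ≤ 1 / 2 by norm_num) (by norm_num)
  rw [← smul_add, hhom _ (by norm_num)] at h
  simp only [smul_eq_mul] at h
  linarith

theorem map_add_smul_neg_le {E : Type*} [AddCommGroup E] [Module ℝ E] {F : E → ℝ}
    (hadd : ∀ x y, F (x + y) ≤ F x + F y)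
    (hhom : ∀ c : ℝ, 0 ≤ c → ∀ y : E, F (c • y) = c * F y) (x v : E) {t : ℝ} (ht : 0 ≤ t) :
    F (x - t • v) ≤ F x + t * F (-v) := by
  rw [← hhom t ht, sub_eq_add_neg, ← smul_neg]
  exact hadd _ _

/-- The navigation map `y ↦ y + F y • v` is injective when `F (-v) < 1`. -/
theorem navigation_injective {E : Type*} [AddCommGroup E] [Module ℝ E] {F : E → ℝ}
    (hadd : ∀ x y, F (x + y) ≤ F x + F y)
    (hhom : ∀ c : ℝ, 0 ≤ c → ∀ y : E, F (c • y) = c * F y) {v : E} (hv : F (-v) < 1) :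
    Function.Injective fun y => y + F y • v := by
  have key : ∀ y z : E, y + F y • v = z + F z • v → F y ≤ F z := by
    intro y z h
    by_contra! hlt
    have hy : y = z - (F y - F z) • v := by
      rw [sub_smul, sub_sub_eq_add_sub, ← h, add_sub_cancel_right]
    have hle := map_add_smul_neg_le hadd hhom z v (sub_pos.2 hlt).le
    rw [← hy] at hle
    nlinarith
  intro y z h
  have hF : F y = F z := le_antisymm (key y z h) (key z y h.symm)
  simpa [hF] using h

/-- The navigation map `y ↦ y + F y • v` is surjective when `F (-v) < 1`. -/
theorem navigation_surjective {E : Type*} [NormedAddCommGroup E] [NormedSpace ℝ E] {F : E → ℝ}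
    (hcont : Continuous F) (hnonneg : ∀ y, 0 ≤ F y)
    (hadd : ∀ x y, F (x + y) ≤ F x + F y)
    (hhom : ∀ c : ℝ, 0 ≤ c → ∀ y : E, F (c • y) = c * F y) {v : E} (hv : F (-v) < 1) :
    Function.Surjective fun y => y + F y • v := by
  intro w
  have hpos : 0 < 1 - F (-v) := sub_pos.2 hv
  set T := F w / (1 - F (-v))
  have hT0 : 0 ≤ T := div_nonneg (hnonneg w) hpos.le
  have hTw : T * (1 - F (-v)) = F w := div_mul_cancel₀ _ hpos.ne'
  have hg : Continuous fun t : ℝ => F (w - t • v) - t := by fun_prop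
  have hmem : (0 : ℝ) ∈ Set.Icc (F (w - T • v) - T) (F (w - (0 : ℝ) • v) - 0) := by
    refine ⟨?_, by simpa using hnonneg w⟩
    linarith [map_add_smul_neg_le hadd hhom w v hT0]
  obtain ⟨t, -, ht⟩ := intermediate_value_Icc' hT0 hg.continuousOn hmem
  refine ⟨w - t • v, ?_⟩
  simp only [sub_eq_zero.1 ht, sub_add_cancel]

/-- There is a unique function `F̃` satisfying the navigation
identity `F̃ (y + F y • v) = F y`; moreover (any) such `F̃` is positively
homogeneous and positive on nonzero vectors. -/
theorem zermelo_navigation_exists_unique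
    {E : Type*} [NormedAddCommGroup E] [NormedSpace ℝ E] [FiniteDimensional ℝ E]
    (F : E → ℝ)
    (hFcont : Continuous F)
    (hFconv : ConvexOn ℝ Set.univ F)
    (hFhom : ∀ c : ℝ, 0 ≤ c → ∀ y : E, F (c • y) = c * F y)
    (hFpos : ∀ y : E, y ≠ 0 → 0 < F y)
    (v : E) (hv : F (-v) < 1) :
    (∃! Ft : E → ℝ, ∀ y : E, Ft (y + F y • v) = F y) ∧
      ∀ Ft : E → ℝ, (∀ y : E, Ft (y + F y • v) = F y) →
        ((∀ c : ℝ, 0 ≤ c → ∀ w : E, Ft (c • w) = c * Ft w) ∧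
          ∀ w : E, w ≠ 0 → 0 < Ft w) := by
  have hF0 : F 0 = 0 := by simpa using hFhom 0 le_rfl 0
  have hnonneg : ∀ y, 0 ≤ F y := fun y => by
    rcases eq_or_ne y 0 with rfl | hy
    · exact hF0.ge
    · exact (hFpos y hy).le
  have hadd := hFconv.map_add_le_of_posHomogeneous hFhom
  have hinj := navigation_injective hadd hFhom hv
  have hsurj := navigation_surjective hFcont hnonneg hadd hFhom hv
  refine ⟨⟨fun w => F (Function.surjInv hsurj w), fun y => ?_, fun G hG => ?_⟩,
    fun Ft hFt => ⟨fun c hc w => ?_, fun w hw => ?_⟩⟩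
  · exact congrArg F (Function.leftInverse_surjInv ⟨hinj, hsurj⟩ y)
  · funext w
    rw [← hG]
    exact congrArg G (Function.surjInv_eq hsurj w).symm
  · obtain ⟨y, rfl⟩ := hsurj w
    have h := hFt (c • y)
    rw [hFhom c hc, mul_smul, ← smul_add] at h
    simpa only [hFt] using h
  · obtain ⟨y, rfl⟩ := hsurj w
    simp only [hFt]
    refine hFpos y ?_
    rintro rfl
    simp [hF0] at hw
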